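/- For every n ≥ 1 and all strictly increasing tuples I, J ∈ ℕ^{n+1} with (I,J) ≠ (ι,ι), the determinant d_{I,J} lies in the ℂ-linear span of the set {p_{a,b,1}(d_{I',J'}) : a,b ∈ ℕ with a+b ≥ 1, and I', J' ∈ ℕ^{n+1} strictly increasing with |I'|+|J'| = |I|+|J|−1}, where |I| denotes the sum of the entries of I. -/

import Mathlib

open MvPolynomial

noncomputable section

/-- The polynomial ring `R = ℂ[Q_{a,b} : a,b ∈ ℕ]`. -/
abbrev RR : Type := MvPolynomial (ℕ × ℕ) ℂ

/-- The coefficient `λ(a,b,w,l) = (−1)^{b+1}·(b+l)!/(l+w−a)!` if `l+w−a ≥ 0`, else `0`. -/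
def lamC (a b : ℕ) (w : ℤ) (l : ℕ) : ℂ :=
  if 0 ≤ (l : ℤ) + w - a then
    (-1) ^ (b + 1) * (Nat.factorial (b + l) : ℂ) /
      (Nat.factorial ((l : ℤ) + w - a).toNat : ℂ)
  else 0

/-- The coefficient `μ(a,b,w,m) = (−1)^a·(a+m)!/(m+w−b)!` if `m+w−b ≥ 0`, else `0`. -/
def muC (a b : ℕ) (w : ℤ) (m : ℕ) : ℂ :=
  if 0 ≤ (m : ℤ) + w - b then
    (-1) ^ a * (Nat.factorial (a + m) : ℂ) /
      (Nat.factorial ((m : ℤ) + w - b).toNat : ℂ)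
  else 0

/-- The derivation `p_{a,b,w}` of `R` with
`p_{a,b,w}(Q_{l,m}) = λ(a,b,w,l)·Q_{l+w,m} + μ(a,b,w,m)·Q_{l,m+w}`, where a summand is
interpreted as `0` whenever its coefficient is `0` (a nonzero coefficient forces the
corresponding shifted index to be a nonnegative integer). -/
def pDer (a b : ℕ) (w : ℤ) : Derivation ℂ RR RR :=
  MvPolynomial.mkDerivation ℂ fun lm : ℕ × ℕ =>
    lamC a b w lm.1 • X (((lm.1 : ℤ) + w).toNat, lm.2) +
      muC a b w lm.2 • X (lm.1, ((lm.2 : ℤ) + w).toNat)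

/-- The determinant `d_{I,J}` of the `(n+1)×(n+1)` matrix with `(r,s)` entry `Q_{i_r,j_s}`. -/
def dDet (n : ℕ) (I J : Fin (n + 1) → ℕ) : RR :=
  Matrix.det (Matrix.of fun r s => (X (I r, J s) : RR))

/-- The tuple `ι = (0,1,…,n)`. -/
def iot (n : ℕ) : Fin (n + 1) → ℕ := fun r => (r : ℕ)

def DD (f : Polynomial ℂ) : Derivation ℂ RR RR :=
  MvPolynomial.mkDerivation ℂ fun lm : ℕ × ℕ =>
    f.eval (lm.1 : ℂ) • X (lm.1 + 1, lm.2) +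
      f.eval (-(lm.2 : ℂ) - 2) • X (lm.1, lm.2 + 1)

def PP (b : ℕ) : Polynomial ℂ :=
  ∏ k ∈ Finset.range b, (-(Polynomial.X + Polynomial.C ((k : ℂ) + 2)))

theorem lam_eq (b l : ℕ) : lamC 0 (b + 1) 1 l = (PP b).eval (l : ℂ) := by
  have h0 : (0 : ℤ) ≤ (l : ℤ) + 1 - (0 : ℕ) := by omega
  have h1 : ((l : ℤ) + 1 - (0 : ℕ)).toNat = l + 1 := by omega
  rw [lamC, if_pos h0, h1]
  have hf : ((l + 1).factorial : ℂ) ≠ 0 := by exact_mod_cast Nat.factorial_ne_zero _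
  rw [div_eq_iff hf]
  induction b with
  | zero => simp [PP, add_comm]
  | succ b ih =>
    rw [PP, Finset.prod_range_succ, ← PP, Polynomial.eval_mul]
    have : (b + 1 + 1 + l).factorial = (b + 1 + 1 + l) * (b + 1 + l).factorial := by
      rw [show b + 1 + 1 + l = (b + 1 + l) + 1 by ring, Nat.factorial_succ]
    rw [this]
    push_cast
    simp only [Polynomial.eval_neg, Polynomial.eval_add, Polynomial.eval_X, Polynomial.eval_C]
    linear_combination (-(l : ℂ) - b - 2) * ih

theorem mu_eq (b m : ℕ) : muC 0 (b + 1) 1 m = (PP b).eval (-(m : ℂ) - 2) := by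
  have key : (PP b).eval (-(m : ℂ) - 2) = (m.descFactorial b : ℂ) := by
    induction b with
    | zero => simp [PP]
    | succ b ih =>
      rw [PP, Finset.prod_range_succ, ← PP, Polynomial.eval_mul, ih, Nat.descFactorial_succ]
      simp only [Polynomial.eval_neg, Polynomial.eval_add, Polynomial.eval_X, Polynomial.eval_C]
      rcases le_or_gt b m with h | h
      · push_cast [Nat.cast_sub h]; ring
      · rw [Nat.descFactorial_of_lt h]; simp
  rw [key, muC]
  split_ifs with h
  · have hb : b ≤ m := by push_cast at h; omega
    have h1 : ((m : ℤ) + 1 - (b + 1 : ℕ)).toNat = m - b := by push_cast; omega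
    rw [h1]
    have hf : ((m - b).factorial : ℂ) ≠ 0 := by exact_mod_cast Nat.factorial_ne_zero _
    rw [div_eq_iff hf, Nat.zero_add, ← Nat.factorial_mul_descFactorial hb]
    push_cast; ring
  · rw [Nat.descFactorial_of_lt (by push_cast at h; omega)]; simp

theorem pDer_eq (b : ℕ) : pDer 0 (b + 1) 1 = DD (PP b) := by
  unfold pDer DD
  congr 1
  funext lm
  rw [lam_eq, mu_eq]
  have : ∀ k : ℕ, ((k : ℤ) + 1).toNat = k + 1 := fun k => by omega
  rw [this, this]

def DL (x : RR) : Polynomial ℂ →ₗ[ℂ] RR where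
  toFun f := DD f x
  map_add' f g := by
    have : DD (f + g) = DD f + DD g := by
      apply MvPolynomial.derivation_ext
      intro i
      simp [DD, mkDerivation_X, add_smul]; abel
    rw [this]; rfl
  map_smul' c f := by
    have : DD (c • f) = c • DD f := by
      apply MvPolynomial.derivation_ext
      intro i
      simp [DD, mkDerivation_X, mul_smul]
    rw [this]; rfl

theorem PP_span (f : Polynomial ℂ) : f ∈ Submodule.span ℂ (Set.range PP) := by
  have hX : ∀ g ∈ Submodule.span ℂ (Set.range PP),
      g * Polynomial.X ∈ Submodule.span ℂ (Set.range PP) := by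
    intro g hg
    induction hg using Submodule.span_induction with
    | mem x hx =>
      obtain ⟨b, rfl⟩ := hx
      have : PP b * Polynomial.X = -PP (b + 1) + (-((b : ℂ) + 2)) • PP b := by
        rw [PP, PP, Finset.prod_range_succ, Polynomial.smul_eq_C_mul]
        simp only [Polynomial.C_neg]
        ring
      rw [this]
      exact add_mem (neg_mem (Submodule.subset_span ⟨_, rfl⟩))
        (Submodule.smul_mem _ _ (Submodule.subset_span ⟨_, rfl⟩))
    | zero => simp
    | add x y _ _ hx hy => rw [add_mul]; exact add_mem hx hy
    | smul c x _ hx => rw [smul_mul_assoc]; exact Submodule.smul_mem _ _ hx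
  have hpow : ∀ k : ℕ, (Polynomial.X : Polynomial ℂ) ^ k ∈ Submodule.span ℂ (Set.range PP) := by
    intro k
    induction k with
    | zero => exact Submodule.subset_span ⟨0, by simp [PP]⟩
    | succ k ih => rw [pow_succ]; exact hX _ ih
  rw [Polynomial.as_sum_range_C_mul_X_pow f]
  refine Submodule.sum_mem _ fun i _ => ?_
  rw [← Polynomial.smul_eq_C_mul]
  exact Submodule.smul_mem _ _ (hpow i)

theorem der_prod {ι : Type*} [DecidableEq ι] (D : Derivation ℂ RR RR) (s : Finset ι)
    (g : ι → RR) : D (∏ i ∈ s, g i) = ∑ i ∈ s, (∏ j ∈ s.erase i, g j) * D (g i) := by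
  induction s using Finset.induction_on with
  | empty => simp
  | insert a s ha ih =>
    rw [Finset.prod_insert ha, Derivation.leibniz, ih, Finset.sum_insert ha,
      Finset.erase_insert ha, smul_eq_mul, smul_eq_mul, add_comm, Finset.mul_sum]
    congr 1
    refine Finset.sum_congr rfl fun i hi => ?_
    have hne : a ≠ i := fun h => ha (h ▸ hi)
    rw [Finset.erase_insert_of_ne hne, Finset.prod_insert (by simp [ha]), mul_assoc]

theorem DD_det (n : ℕ) (f : Polynomial ℂ) (I J : Fin (n + 1) → ℕ) :
    DD f (dDet n I J) =
      ∑ r, f.eval (I r : ℂ) • dDet n (Function.update I r (I r + 1)) J +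
      ∑ s, f.eval (-(J s : ℂ) - 2) • dDet n I (Function.update J s (J s + 1)) := by
  have hX : ∀ l m : ℕ, DD f (X (l, m)) = f.eval (l : ℂ) • X (l + 1, m) +
      f.eval (-(m : ℂ) - 2) • X (l, m + 1) := fun l m => by
    simp [DD, mkDerivation_X]
  have h1 : ∀ (σ : Equiv.Perm (Fin (n+1))) (i : Fin (n+1)),
      (∏ j, (X (Function.update I (σ i) (I (σ i) + 1) (σ j), J j) : RR)) =
      (∏ j ∈ Finset.univ.erase i, X (I (σ j), J j)) * X (I (σ i) + 1, J i) := by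
    intro σ i
    rw [← Finset.prod_erase_mul _ _ (Finset.mem_univ i)]
    congr 1
    · refine Finset.prod_congr rfl fun j hj => ?_
      rw [Function.update_of_ne]
      exact fun h => (Finset.ne_of_mem_erase hj) (σ.injective h)
    · simp
  have h2 : ∀ (σ : Equiv.Perm (Fin (n+1))) (i : Fin (n+1)),
      (∏ j, (X (I (σ j), Function.update J i (J i + 1) j) : RR)) =
      (∏ j ∈ Finset.univ.erase i, X (I (σ j), J j)) * X (I (σ i), J i + 1) := by
    intro σ i
    rw [← Finset.prod_erase_mul _ _ (Finset.mem_univ i)]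
    congr 1
    · refine Finset.prod_congr rfl fun j hj => ?_
      rw [Function.update_of_ne (Finset.ne_of_mem_erase hj)]
    · simp
  simp only [dDet, Matrix.det_apply, Matrix.of_apply, map_sum, Finset.smul_sum]
  rw [Finset.sum_comm (s := Finset.univ (α := Fin (n+1))),
    Finset.sum_comm (s := Finset.univ (α := Fin (n+1))), ← Finset.sum_add_distrib]
  refine Finset.sum_congr rfl fun σ _ => ?_
  rw [← Equiv.sum_comp σ (fun r => f.eval (I r : ℂ) • Equiv.Perm.sign σ •
    (∏ j, (X (Function.update I r (I r + 1) (σ j), J j) : RR))), ← Finset.sum_add_distrib]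
  simp only [h1, h2]
  have hs : ∀ y : RR, DD f (Equiv.Perm.sign σ • y) = Equiv.Perm.sign σ • DD f y := by
    intro y
    rcases Int.units_eq_one_or (Equiv.Perm.sign σ) with h | h <;> rw [h] <;> simp
  rw [hs, der_prod, Finset.smul_sum]
  refine Finset.sum_congr rfl fun i _ => ?_
  rw [hX, mul_add, smul_add, mul_smul_comm, mul_smul_comm, smul_comm, 
    smul_comm (Equiv.Perm.sign σ) (f.eval (-(J i : ℂ) - 2))]

theorem exists_lower (n : ℕ) (I : Fin (n + 1) → ℕ) (hI : StrictMono I) (h : I ≠ iot n) :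
    ∃ (r : Fin (n + 1)) (I' : Fin (n + 1) → ℕ), StrictMono I' ∧
      I = Function.update I' r (I' r + 1) := by
  have hge : ∀ r : Fin (n + 1), (r : ℕ) ≤ I r := by
    rintro ⟨r, hr⟩
    induction r with
    | zero => simp
    | succ k ih =>
      have h1 := ih (by omega)
      have h2 : I ⟨k, by omega⟩ < I ⟨k + 1, hr⟩ := hI (by simp)
      simp only at h1 ⊢
      omega
  have hex : ∃ k : ℕ, ∃ hk : k < n + 1, k < I ⟨k, hk⟩ := by
    by_contra! hc
    exact h (funext fun r => le_antisymm (hc r r.2) (hge r))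
  classical
  obtain ⟨hk, hlt⟩ := Nat.find_spec hex
  have hmin := fun m (hm : m < Nat.find hex) => Nat.find_min hex hm
  generalize Nat.find hex = k at hk hlt hmin
  refine ⟨⟨k, hk⟩, Function.update I ⟨k, hk⟩ (I ⟨k, hk⟩ - 1), ?_, ?_⟩
  · intro x y hxy
    have hI' := hI hxy
    by_cases hy : y = ⟨k, hk⟩
    · subst hy
      rw [Function.update_of_ne hxy.ne, Function.update_self]
      have hxk : (x : ℕ) < k := hxy
      have := hmin x hxk
      push Not at this
      have := this x.2
      simp only [Fin.eta] at this
      omega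
    · rw [Function.update_of_ne hy]
      by_cases hx : x = ⟨k, hk⟩
      · subst hx
        rw [Function.update_self]; omega
      · rw [Function.update_of_ne hx]; exact hI'
  · rw [Function.update_self, Function.update_idem, Nat.sub_add_cancel (by omega),
      Function.update_eq_self]

theorem sum_upd (n : ℕ) (I : Fin (n + 1) → ℕ) (r : Fin (n + 1)) :
    ∑ i, Function.update I r (I r + 1) i = ∑ i, I i + 1 := by
  rw [Finset.sum_update_of_mem (Finset.mem_univ r),
    ← Finset.add_sum_erase _ _ (Finset.mem_univ r), Finset.sdiff_singleton_eq_erase]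
  ring

theorem DD_mem (n : ℕ) (I' J' : Fin (n + 1) → ℕ) (N : ℕ)
    (hI : StrictMono I') (hJ : StrictMono J') (hN : (∑ r, I' r) + (∑ s, J' s) + 1 = N)
    (f : Polynomial ℂ) :
    DD f (dDet n I' J') ∈ Submodule.span ℂ
      {p : RR | ∃ (a b : ℕ) (I' J' : Fin (n + 1) → ℕ), 1 ≤ a + b ∧
        StrictMono I' ∧ StrictMono J' ∧
        (∑ r, I' r) + (∑ s, J' s) + 1 = N ∧
        p = pDer a b 1 (dDet n I' J')} := by
  have h : DL (dDet n I' J') f ∈ (Submodule.span ℂ (Set.range PP)).map (DL (dDet n I' J')) :=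
    Submodule.mem_map_of_mem (PP_span f)
  rw [Submodule.map_span] at h
  refine Submodule.span_mono ?_ h
  rintro _ ⟨_, ⟨b, rfl⟩, rfl⟩
  exact ⟨0, b + 1, I', J', by omega, hI, hJ, hN, by rw [pDer_eq]; rfl⟩

/-- For strictly increasing `I, J` with `(I,J) ≠ (ι,ι)`, `d_{I,J}` lies in the ℂ-span of the
elements `p_{a,b,1}(d_{I',J'})` with `a + b ≥ 1` and `I', J'` strictly increasing with
`|I'| + |J'| = |I| + |J| − 1`. -/
theorem dDet_mem_span_pDer (n : ℕ) (hn : 1 ≤ n) (I J : Fin (n + 1) → ℕ)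
    (hI : StrictMono I) (hJ : StrictMono J) (hne : (I, J) ≠ (iot n, iot n)) :
    dDet n I J ∈ Submodule.span ℂ
      {p : RR | ∃ (a b : ℕ) (I' J' : Fin (n + 1) → ℕ), 1 ≤ a + b ∧
        StrictMono I' ∧ StrictMono J' ∧
        (∑ r, I' r) + (∑ s, J' s) + 1 = (∑ r, I r) + ∑ s, J s ∧
        p = pDer a b 1 (dDet n I' J')} := by
  have hneg : ∀ a b : ℕ, (-(b : ℂ) - 2) ≠ a := fun a b h => by
    have h' : ((-(b : ℤ) - 2 : ℤ) : ℂ) = ((a : ℤ) : ℂ) := by push_cast; exact h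
    have := Int.cast_injective h'
    omega
  by_cases h : I = iot n
  · have h2 : J ≠ iot n := fun h' => hne (by rw [h, h'])
    obtain ⟨r, J', hJ', e⟩ := exists_lower n J hJ h2
    let g : Polynomial ℂ := (∏ s ∈ Finset.univ.erase r,
      (Polynomial.X - Polynomial.C (-(J' s : ℂ) - 2))) *
      ∏ s, (Polynomial.X - Polynomial.C (I s : ℂ))
    have hg : g.eval (-(J' r : ℂ) - 2) ≠ 0 := by
      simp only [g, Polynomial.eval_mul, Polynomial.eval_prod, Polynomial.eval_sub,
        Polynomial.eval_X, Polynomial.eval_C]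
      refine mul_ne_zero (Finset.prod_ne_zero_iff.2 fun s hs => ?_)
        (Finset.prod_ne_zero_iff.2 fun s _ => sub_ne_zero.2 (hneg _ _))
      intro h0
      have h0' : (J' s : ℂ) = J' r := by linear_combination h0
      exact (Finset.ne_of_mem_erase hs) (hJ'.injective (Nat.cast_injective h0'))
    have hI0 : ∀ s, g.eval (I s : ℂ) = 0 := fun s => by
      simp only [g, Polynomial.eval_mul, Polynomial.eval_prod]
      rw [Finset.prod_eq_zero (Finset.mem_univ s) (by simp), mul_zero]
    have hJ0 : ∀ s, s ≠ r → g.eval (-(J' s : ℂ) - 2) = 0 := fun s hs => by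
      simp only [g, Polynomial.eval_mul, Polynomial.eval_prod]
      rw [Finset.prod_eq_zero (Finset.mem_erase.2 ⟨hs, Finset.mem_univ s⟩) (by simp), zero_mul]
    have hm := DD_mem n I J' ((∑ r, I r) + ∑ s, J s) hI hJ'
      (by conv_rhs => rw [e, sum_upd]
          ring) g
    have heq : DD g (dDet n I J') = g.eval (-(J' r : ℂ) - 2) • dDet n I J := by
      rw [DD_det, Finset.sum_eq_zero (fun s _ => by rw [hI0, zero_smul]), zero_add,
        Finset.sum_eq_single r (fun s _ hs => by rw [hJ0 s hs, zero_smul]) (by simp), ← e]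
    rw [heq] at hm
    exact (Submodule.smul_mem_iff _ hg).1 hm
  · obtain ⟨r, I', hI', e⟩ := exists_lower n I hI h
    let g : Polynomial ℂ := (∏ s ∈ Finset.univ.erase r,
      (Polynomial.X - Polynomial.C (I' s : ℂ))) *
      ∏ s, (Polynomial.X - Polynomial.C (-(J s : ℂ) - 2))
    have hg : g.eval (I' r : ℂ) ≠ 0 := by
      simp only [g, Polynomial.eval_mul, Polynomial.eval_prod, Polynomial.eval_sub,
        Polynomial.eval_X, Polynomial.eval_C]
      refine mul_ne_zero (Finset.prod_ne_zero_iff.2 fun s hs => ?_)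
        (Finset.prod_ne_zero_iff.2 fun s _ => sub_ne_zero.2 (hneg _ _).symm)
      intro h0
      have h0' : (I' s : ℂ) = I' r := by linear_combination -h0
      exact (Finset.ne_of_mem_erase hs) (hI'.injective (Nat.cast_injective h0'))
    have hJ0 : ∀ s, g.eval (-(J s : ℂ) - 2) = 0 := fun s => by
      simp only [g, Polynomial.eval_mul, Polynomial.eval_prod]
      rw [Finset.prod_eq_zero (i := s) (Finset.mem_univ s) (by simp), mul_zero]
    have hI0 : ∀ s, s ≠ r → g.eval (I' s : ℂ) = 0 := fun s hs => by
      simp only [g, Polynomial.eval_mul, Polynomial.eval_prod]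
      rw [Finset.prod_eq_zero (Finset.mem_erase.2 ⟨hs, Finset.mem_univ s⟩) (by simp), zero_mul]
    have hm := DD_mem n I' J ((∑ r, I r) + ∑ s, J s) hI' hJ
      (by conv_rhs => rw [e, sum_upd]
          ring) g
    have heq : DD g (dDet n I' J) = g.eval (I' r : ℂ) • dDet n I J := by
      rw [DD_det, add_comm, Finset.sum_eq_zero (fun s _ => by rw [hJ0, zero_smul]), zero_add,
        Finset.sum_eq_single r (fun s _ hs => by rw [hI0 s hs, zero_smul]) (by simp), ← e]
    rw [heq] at hm
    exact (Submodule.smul_mem_iff _ hg).1 hm
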